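/- arXiv:1405.4750 — 2 statements merged into one kernel-verified Lean document; each statement's English description precedes it below -/
import Mathlib

section
/- With the dG setup below and assuming the mesh-ratio bound, there exists a constant C > 0 depending only on q and ρ (and not on the partition) such that for all Φ ∈ V_q: ‖G⁺[Φ]‖_{L²(0,1)} ≤ C |Φ|_dG and ‖G⁻[Φ]‖_{L²(0,1)} ≤ C |Φ|_dG. -/
open scoped BigOperators
open MeasureTheory Set

namespace DG

noncomputable def pev (q : ℕ) (c : ℕ → ℕ → ℝ) (n : ℕ) (y : ℝ) : ℝ :=
  ∑ k ∈ Finset.range (q + 1), c n k * y ^ k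

noncomputable def pev' (q : ℕ) (c : ℕ → ℕ → ℝ) (n : ℕ) (y : ℝ) : ℝ :=
  ∑ k ∈ Finset.range (q + 1), (k : ℝ) * c n k * y ^ (k - 1)

noncomputable def inner2 (q N : ℕ) (x : ℕ → ℝ) (c d : ℕ → ℕ → ℝ) : ℝ :=
  ∑ n ∈ Finset.range N, ∫ y in (x n)..(x (n + 1)), pev q c n y * pev q d n y

noncomputable def nsq (q N : ℕ) (x : ℕ → ℝ) (c : ℕ → ℕ → ℝ) : ℝ :=
  inner2 q N x c c

noncomputable def intg (q N : ℕ) (x : ℕ → ℝ) (c : ℕ → ℕ → ℝ) : ℝ :=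
  ∑ n ∈ Finset.range N, ∫ y in (x n)..(x (n + 1)), pev q c n y

noncomputable def valR (q : ℕ) (x : ℕ → ℝ) (c : ℕ → ℕ → ℝ) (n : ℕ) : ℝ :=
  pev q c n (x n)

noncomputable def valL (q N : ℕ) (x : ℕ → ℝ) (c : ℕ → ℕ → ℝ) (n : ℕ) : ℝ :=
  if n = 0 then pev q c (N - 1) (x N) else pev q c (n - 1) (x n)

noncomputable def jmp (q N : ℕ) (x : ℕ → ℝ) (c : ℕ → ℕ → ℝ) (n : ℕ) : ℝ :=
  valL q N x c n - valR q x c n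

noncomputable def Bm (q N : ℕ) (x : ℕ → ℝ) (w Ψ : ℕ → ℕ → ℝ) : ℝ :=
  (∑ n ∈ Finset.range N, ∫ y in (x n)..(x (n + 1)), pev' q w n y * pev q Ψ n y)
    - ∑ n ∈ Finset.range N, jmp q N x w n * valL q N x Ψ n

noncomputable def Bp (q N : ℕ) (x : ℕ → ℝ) (w Ψ : ℕ → ℕ → ℝ) : ℝ :=
  (∑ n ∈ Finset.range N, ∫ y in (x n)..(x (n + 1)), pev' q w n y * pev q Ψ n y)
    - ∑ n ∈ Finset.range N, jmp q N x w n * valR q x Ψ n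

def IsGminus (q N : ℕ) (x : ℕ → ℝ) (w g : ℕ → ℕ → ℝ) : Prop :=
  ∀ Ψ : ℕ → ℕ → ℝ, inner2 q N x g Ψ = Bm q N x w Ψ

def IsGplus (q N : ℕ) (x : ℕ → ℝ) (w g : ℕ → ℕ → ℝ) : Prop :=
  ∀ Ψ : ℕ → ℕ → ℝ, inner2 q N x g Ψ = Bp q N x w Ψ

noncomputable def hseg (x : ℕ → ℝ) (n : ℕ) : ℝ := x (n + 1) - x n

noncomputable def hprev (N : ℕ) (x : ℕ → ℝ) (n : ℕ) : ℝ :=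
  if n = 0 then hseg x (N - 1) else hseg x (n - 1)

noncomputable def dGsq (q N : ℕ) (x : ℕ → ℝ) (w : ℕ → ℕ → ℝ) : ℝ :=
  ∑ n ∈ Finset.range N,
    ((∫ y in (x n)..(x (n + 1)), (pev' q w n y) ^ 2)
      + 2 * (jmp q N x w n) ^ 2 / (hprev N x n + hseg x n))

def Partition (N : ℕ) (x : ℕ → ℝ) : Prop :=
  2 ≤ N ∧ x 0 = 0 ∧ x N = 1 ∧ ∀ n < N, x n < x (n + 1)

def MeshRatio (N : ℕ) (x : ℕ → ℝ) (ρ : ℝ) : Prop :=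
  ∀ n < N, hseg x n ≤ ρ * hseg x ((n + 1) % N) ∧ hseg x ((n + 1) % N) ≤ ρ * hseg x n

end DG

namespace DG

lemma trace_unit (q : ℕ) : ∃ K > (0 : ℝ), ∀ p : Polynomial ℝ, p.natDegree ≤ q →
    p.eval 0 ^ 2 ≤ K * ∫ t in (0 : ℝ)..1, (p.eval t) ^ 2 := by
  let P : (Fin (q + 1) → ℝ) → ℝ → ℝ := fun v t => ∑ i, v i * t ^ (i : ℕ)
  let F : (Fin (q + 1) → ℝ) → ℝ := fun v => ∫ t in (0 : ℝ)..1, (P v t) ^ 2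
  have hPc : Continuous (fun z : (Fin (q + 1) → ℝ) × ℝ => P z.1 z.2) := by
    simp only [P]; fun_prop
  have hFc : Continuous F := by
    apply intervalIntegral.continuous_parametric_intervalIntegral_of_continuous'
    exact hPc.pow 2
  have hpos : ∀ v, v ≠ 0 → 0 < F v := by
    intro v hv
    by_contra hcon
    apply hv
    have hz : ∀ t ∈ Icc (0 : ℝ) 1, P v t = 0 := by
      intro t ht
      by_contra hne
      apply hcon
      apply intervalIntegral.integral_pos zero_lt_one
      · exact ((hPc.comp (Continuous.prodMk_right v)).pow 2).continuousOn
      · intro y _; positivity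
      · exact ⟨t, ht, by positivity⟩
    let p : Polynomial ℝ := ∑ i : Fin (q + 1), Polynomial.monomial (i : ℕ) (v i)
    have hp : p = 0 := by
      apply Polynomial.eq_zero_of_infinite_isRoot
      apply (Set.Icc_infinite (zero_lt_one' ℝ)).mono
      intro t ht
      have := hz t ht
      simpa [p, P, Polynomial.IsRoot, Polynomial.eval_finsetSum] using this
    funext i
    have h2 : p.coeff i = v i := by
      simp only [p, Polynomial.finsetSum_coeff, Polynomial.coeff_monomial]
      rw [Finset.sum_eq_single i]
      · simp
      · intro j _ hj
        rw [if_neg]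
        intro h; exact hj (Fin.ext h)
      · simp
    rw [← h2, hp]; simp
  have hne : (Metric.sphere (0 : Fin (q + 1) → ℝ) 1).Nonempty := NormedSpace.sphere_nonempty.mpr zero_le_one
  obtain ⟨u, hu, hmin⟩ := (isCompact_sphere (0 : Fin (q + 1) → ℝ) 1).exists_isMinOn hne hFc.continuousOn
  have hu0 : u ≠ 0 := by
    rintro rfl
    simp at hu
  have hm := hpos u hu0
  have hhom : ∀ (a : ℝ) v, F (a • v) = a ^ 2 * F v := by
    intro a v
    simp only [F]
    rw [← intervalIntegral.integral_const_mul]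
    congr 1
    funext t
    rw [← mul_pow]
    congr 1
    simp only [P, Finset.mul_sum, Pi.smul_apply, smul_eq_mul, mul_assoc]
  have key : ∀ v, ‖v‖ ^ 2 * F u ≤ F v := by
    intro v
    by_cases hv : v = 0
    · subst hv
      have := hhom 0 0
      simp at this
      simp [this]
    · have hn : ‖v‖ ≠ 0 := norm_ne_zero_iff.mpr hv
      have h1 : ‖v‖⁻¹ • v ∈ Metric.sphere (0 : Fin (q + 1) → ℝ) 1 := by
        simp [norm_smul, hn]
      have h2 : F u ≤ F (‖v‖⁻¹ • v) := hmin h1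
      rw [hhom] at h2
      calc ‖v‖ ^ 2 * F u ≤ ‖v‖ ^ 2 * (‖v‖⁻¹ ^ 2 * F v) := by gcongr
        _ = F v := by field_simp
  refine ⟨(F u)⁻¹, inv_pos.mpr hm, ?_⟩
  intro p hp
  let v : Fin (q + 1) → ℝ := fun i => p.coeff i
  have hPv : ∀ t, p.eval t = P v t := by
    intro t
    rw [Polynomial.eval_eq_sum_range' (Nat.lt_succ_of_le hp), Finset.sum_range]
  have h0 : |p.eval 0| ≤ ‖v‖ := by
    have := norm_le_pi_norm v 0
    simpa [v, Polynomial.coeff_zero_eq_eval_zero] using this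
  have h1 : p.eval 0 ^ 2 ≤ ‖v‖ ^ 2 := by
    rw [← sq_abs]; gcongr
  have h2 : (∫ t in (0 : ℝ)..1, (p.eval t) ^ 2) = F v := by
    simp only [F, hPv]
  rw [h2]
  calc p.eval 0 ^ 2 ≤ ‖v‖ ^ 2 := h1
    _ = (F u)⁻¹ * (‖v‖ ^ 2 * F u) := by field_simp
    _ ≤ (F u)⁻¹ * F v := by have := key v; gcongr

lemma pev_cont (q : ℕ) (c : ℕ → ℕ → ℝ) (n : ℕ) : Continuous (pev q c n) := by
  unfold pev; fun_prop

lemma pev'_cont (q : ℕ) (c : ℕ → ℕ → ℝ) (n : ℕ) : Continuous (pev' q c n) := by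
  unfold pev'; fun_prop

lemma trace_cell (q : ℕ) : ∃ K > (0 : ℝ), ∀ (c : ℕ → ℕ → ℝ) (n : ℕ) (a b : ℝ), a < b →
    (b - a) * pev q c n a ^ 2 ≤ K * (∫ y in a..b, pev q c n y ^ 2) ∧
    (b - a) * pev q c n b ^ 2 ≤ K * (∫ y in a..b, pev q c n y ^ 2) := by
  obtain ⟨K, hK, h⟩ := trace_unit q
  refine ⟨K, hK, ?_⟩
  intro c n a b hab
  have hba : 0 < b - a := sub_pos.mpr hab
  let p : Polynomial ℝ := ∑ k ∈ Finset.range (q + 1), Polynomial.C (c n k) * Polynomial.X ^ k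
  have hpd : p.natDegree ≤ q := by
    apply Polynomial.natDegree_sum_le_of_forall_le
    intro k hk
    exact (Polynomial.natDegree_C_mul_X_pow_le _ _).trans (Nat.lt_succ_iff.mp (Finset.mem_range.mp hk))
  have hpe : ∀ y, p.eval y = pev q c n y := by
    intro y
    simp [p, pev, Polynomial.eval_finsetSum]
  have gen : ∀ s d : ℝ, (∫ t in (0 : ℝ)..1, pev q c n (s * t + d) ^ 2)
      = (b - a)⁻¹ * (∫ y in a..b, pev q c n y ^ 2) →
      (b - a) * pev q c n d ^ 2 ≤ K * (∫ y in a..b, pev q c n y ^ 2) := by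
    intro s d hs
    have hd : (p.comp (Polynomial.C s * Polynomial.X + Polynomial.C d)).natDegree ≤ q := by
      refine Polynomial.natDegree_comp_le.trans ?_
      calc _ ≤ q * 1 := Nat.mul_le_mul hpd Polynomial.natDegree_linear_le
        _ = q := mul_one q
    have h1 := h _ hd
    simp only [Polynomial.eval_comp, Polynomial.eval_add, Polynomial.eval_mul, Polynomial.eval_C,
      Polynomial.eval_X, hpe, mul_zero, zero_add] at h1
    rw [hs] at h1
    calc (b - a) * pev q c n d ^ 2 ≤ (b - a) * (K * ((b - a)⁻¹ * ∫ y in a..b, pev q c n y ^ 2)) := by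
          gcongr
      _ = _ := by field_simp
  constructor
  · apply gen (b - a)
    rw [intervalIntegral.integral_comp_mul_add (fun y => pev q c n y ^ 2) hba.ne']
    simp
  · apply gen (-(b - a))
    rw [intervalIntegral.integral_comp_mul_add (fun y => pev q c n y ^ 2) (neg_ne_zero.mpr hba.ne'),
      intervalIntegral.integral_symm]
    have e1 : -(b - a) * 1 + b = a := by ring
    have e2 : -(b - a) * 0 + b = b := by ring
    rw [e1, e2, smul_eq_mul, inv_neg, neg_mul_neg]

def prv (N n : ℕ) : ℕ := if n = 0 then N - 1 else n - 1

lemma sum_prv (N : ℕ) (hN : 2 ≤ N) (F : ℕ → ℝ) :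
    ∑ n ∈ Finset.range N, F (prv N n) = ∑ n ∈ Finset.range N, F n := by
  obtain ⟨M, rfl⟩ : ∃ M, N = M + 1 := ⟨N - 1, by omega⟩
  rw [Finset.sum_range_succ', Finset.sum_range_succ]
  simp [prv]

/-- Absorption argument, with the trace taken from the cell `σ n` at node `n`. -/
lemma absorb (q N : ℕ) (x : ℕ → ℝ) (ρ K : ℝ) (hρ : 1 ≤ ρ) (hK : 0 < K)
    (hx : ∀ n < N, x n < x (n + 1)) (Φ G : ℕ → ℕ → ℝ) (σ : ℕ → ℕ) (t : ℕ → ℝ)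
    (hσ : ∀ n < N, σ n < N)
    (hsum : ∀ F : ℕ → ℝ, ∑ n ∈ Finset.range N, F (σ n) = ∑ n ∈ Finset.range N, F n)
    (htr : ∀ n < N, hseg x (σ n) * t n ^ 2
      ≤ K * ∫ y in (x (σ n))..(x (σ n + 1)), pev q G (σ n) y ^ 2)
    (hmesh : ∀ n < N, 0 < hprev N x n + hseg x n ∧
      hprev N x n + hseg x n ≤ (1 + ρ) * hseg x (σ n))
    (hG : nsq q N x G = (∑ n ∈ Finset.range N,
      ∫ y in (x n)..(x (n + 1)), pev' q Φ n y * pev q G n y)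
      - ∑ n ∈ Finset.range N, jmp q N x Φ n * t n) :
    nsq q N x G ≤ (2 + 2 * K * (1 + ρ)) * dGsq q N x Φ := by
  set I : ℕ → ℝ := fun n => ∫ y in (x n)..(x (n + 1)), pev q G n y ^ 2 with hI
  set A : ℕ → ℝ := fun n => ∫ y in (x n)..(x (n + 1)), pev' q Φ n y ^ 2 with hA
  set J : ℕ → ℝ := fun n => 2 * (jmp q N x Φ n) ^ 2 / (hprev N x n + hseg x n) with hJ
  have hn : nsq q N x G = ∑ n ∈ Finset.range N, I n := by
    simp only [nsq, inner2, hI, sq]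
  have hd : dGsq q N x Φ = (∑ n ∈ Finset.range N, A n) + ∑ n ∈ Finset.range N, J n := by
    rw [← Finset.sum_add_distrib]; rfl
  have hA0 : 0 ≤ ∑ n ∈ Finset.range N, A n := by
    apply Finset.sum_nonneg
    intro n hn
    apply intervalIntegral.integral_nonneg (hx n (Finset.mem_range.mp hn)).le
    intro y _; positivity
  have hJ0 : 0 ≤ ∑ n ∈ Finset.range N, J n := by
    apply Finset.sum_nonneg
    intro n hn
    have := (hmesh n (Finset.mem_range.mp hn)).1
    simp only [hJ]; positivity
  have h1 : (∑ n ∈ Finset.range N, ∫ y in (x n)..(x (n + 1)), pev' q Φ n y * pev q G n y)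
      ≤ ∑ n ∈ Finset.range N, (A n + 1 / 4 * I n) := by
    apply Finset.sum_le_sum
    intro n hn
    simp only [hA, hI]
    have c1 := pev_cont q G n
    have c2 := pev'_cont q Φ n
    have i1 : IntervalIntegrable (fun y => pev' q Φ n y ^ 2) volume (x n) (x (n + 1)) :=
      Continuous.intervalIntegrable (by fun_prop) _ _
    have i2 : IntervalIntegrable (fun y => 1 / 4 * pev q G n y ^ 2) volume (x n) (x (n + 1)) :=
      Continuous.intervalIntegrable (by fun_prop) _ _
    have i3 : IntervalIntegrable (fun y => pev' q Φ n y * pev q G n y) volume (x n) (x (n + 1)) :=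
      Continuous.intervalIntegrable (by fun_prop) _ _
    rw [← intervalIntegral.integral_const_mul, ← intervalIntegral.integral_add i1 i2]
    apply intervalIntegral.integral_mono_on (hx n (Finset.mem_range.mp hn)).le i3 (i1.add i2)
    intro y _
    nlinarith [sq_nonneg (pev' q Φ n y - 1 / 2 * pev q G n y)]
  have h2 : -(∑ n ∈ Finset.range N, jmp q N x Φ n * t n)
      ≤ ∑ n ∈ Finset.range N, (K * (1 + ρ) * J n + 1 / 4 * I (σ n)) := by
    rw [← Finset.sum_neg_distrib]
    apply Finset.sum_le_sum
    intro n hn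
    have hnN := Finset.mem_range.mp hn
    obtain ⟨hp, hm⟩ := hmesh n hnN
    have ht := htr n hnN
    have hh : 0 < hseg x (σ n) := sub_pos.mpr (hx _ (hσ n hnN))
    set j := jmp q N x Φ n
    set H := hseg x (σ n)
    have e1 : -(j * t n) ≤ K * j ^ 2 / H + H * t n ^ 2 / (4 * K) := by
      have : K * j ^ 2 / H + H * t n ^ 2 / (4 * K) + j * t n
          = (2 * K * j + H * t n) ^ 2 / (4 * K * H) := by field_simp; ring
      have h0 : 0 ≤ (2 * K * j + H * t n) ^ 2 / (4 * K * H) := by positivity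
      linarith
    have e2 : H * t n ^ 2 / (4 * K) ≤ 1 / 4 * I (σ n) := by
      rw [div_le_iff₀ (by positivity)]
      calc _ ≤ K * I (σ n) := ht
        _ = _ := by ring
    have e3 : K * j ^ 2 / H ≤ K * (1 + ρ) * J n := by
      have hr : 0 < 1 + ρ := by linarith
      have : K * j ^ 2 / H = K * (1 + ρ) * (j ^ 2 / ((1 + ρ) * H)) := by field_simp
      rw [this]
      have e4 : j ^ 2 / ((1 + ρ) * H) ≤ J n := by
        simp only [hJ]
        apply div_le_div₀ (by positivity) _ hp hm
        nlinarith [sq_nonneg j]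
      gcongr
    linarith
  rw [Finset.sum_add_distrib, ← Finset.mul_sum] at h1
  rw [Finset.sum_add_distrib, ← Finset.mul_sum, ← Finset.mul_sum, hsum I] at h2
  rw [hn] at hG ⊢
  rw [hd]
  have hKr : 0 < K * (1 + ρ) := by
    have hr : 0 < 1 + ρ := by linarith
    positivity
  nlinarith [mul_nonneg hKr.le hA0]

end DG

/-- dG-norm stability of the discrete gradients,
Lemma "Properties of discrete gradients", second estimate in (eq:inverse-Gs):
under a mesh-ratio bound ρ there is C > 0 depending only on q and ρ with
‖G±[Φ]‖_{L²(0,1)} ≤ C |Φ|_dG for all Φ ∈ V_q.  Stated with squared norms.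
Elements of V_q are represented by cellwise polynomial coefficients. -/
theorem stmt_5 (q : ℕ) (hq : 1 ≤ q) (ρ : ℝ) (hρ : 1 ≤ ρ) :
    ∃ C > (0 : ℝ), ∀ (N : ℕ) (x : ℕ → ℝ), DG.Partition N x → DG.MeshRatio N x ρ →
      ∀ Φ Gp Gm : ℕ → ℕ → ℝ, DG.IsGplus q N x Φ Gp → DG.IsGminus q N x Φ Gm →
        DG.nsq q N x Gp ≤ C * DG.dGsq q N x Φ ∧
        DG.nsq q N x Gm ≤ C * DG.dGsq q N x Φ := by
  obtain ⟨K, hK, hT⟩ := DG.trace_cell q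
  have hr : 0 < 1 + ρ := by linarith
  refine ⟨2 + 2 * K * (1 + ρ), by positivity, ?_⟩
  rintro N x ⟨hN, -, -, hx⟩ hM Φ Gp Gm hp hm
  have hprv : ∀ n < N, DG.prv N n < N := by
    intro n hn
    unfold DG.prv
    split_ifs <;> omega
  have hhp : ∀ n, DG.hprev N x n = DG.hseg x (DG.prv N n) := by
    intro n
    unfold DG.hprev DG.prv
    split_ifs <;> rfl
  have hmod : ∀ n < N, (DG.prv N n + 1) % N = n := by
    intro n hn
    unfold DG.prv
    split_ifs with h
    · subst h
      rw [Nat.sub_add_cancel (by omega), Nat.mod_self]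
    · rw [Nat.sub_add_cancel (by omega), Nat.mod_eq_of_lt hn]
  have hh : ∀ n < N, 0 < DG.hseg x n := fun n hn => sub_pos.mpr (hx n hn)
  constructor
  · refine DG.absorb q N x ρ K hρ hK hx Φ Gp id (DG.valR q x Gp) (fun n hn => hn)
      (fun F => rfl) ?_ ?_ (hp Gp)
    · intro n hn
      exact (hT Gp n _ _ (hx n hn)).1
    · intro n hn
      have h1 := (hM _ (hprv n hn)).1
      rw [hmod n hn] at h1
      rw [hhp]
      have := hh n hn
      have := hh _ (hprv n hn)
      simp only [id]
      exact ⟨by linarith, by linarith⟩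
  · refine DG.absorb q N x ρ K hρ hK hx Φ Gm (DG.prv N) (DG.valL q N x Gm) hprv
      (DG.sum_prv N hN) ?_ ?_ (hm Gm)
    · intro n hn
      have h1 := (hT Gm (DG.prv N n) _ _ (hx _ (hprv n hn))).2
      have h2 : DG.valL q N x Gm n = DG.pev q Gm (DG.prv N n) (x (DG.prv N n + 1)) := by
        unfold DG.valL DG.prv
        split_ifs with h
        · rw [Nat.sub_add_cancel (by omega)]
        · rw [Nat.sub_add_cancel (by omega)]
      rw [h2]
      exact h1
    · intro n hn
      have h1 := (hM _ (hprv n hn)).2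
      rw [hmod n hn] at h1
      rw [hhp]
      have := hh n hn
      have := hh _ (hprv n hn)
      exact ⟨by linarith, by linarith⟩
end

section
/- With the dG setup below, let w ∈ C¹([0,1]) with w(0) = w(1) (so that ∫₀¹ w′ dx = 0), let r ∈ V_q with ∫₀¹ r dx = 0, and let Q ∈ V_q be an element with G⁻[Q] = r. Then ‖G⁻[ Q − S_q⁺[w] ]‖_{L²(0,1)} ≤ ‖ r − P_q[w′] ‖_{L²(0,1)}, where P_q[w′] is the L²(0,1)-orthogonal projection of w′ onto V_q. -/
open scoped BigOperators
open MeasureTheory Set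

namespace DG

/-- The interpolation operator S_q⁺: on each cell I_n, p matches w at the left
endpoint x_n and has the same moments as w against all polynomials of degree
≤ q−1 (represented by their coefficients d). -/
def IsSqPlus (q N : ℕ) (x : ℕ → ℝ) (w : ℝ → ℝ) (p : ℕ → ℕ → ℝ) : Prop :=
  ∀ n < N, pev q p n (x n) = w (x n) ∧
    ∀ d : ℕ → ℝ,
      (∫ y in (x n)..(x (n + 1)),
        (pev q p n y - w y) * (∑ k ∈ Finset.range q, d k * y ^ k)) = 0

end DG

namespace DGaux
open DG

lemma cont_pev (q c n) : Continuous (pev q c n) := by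
  unfold pev; fun_prop

lemma cont_pev' (q c n) : Continuous (pev' q c n) := by
  unfold pev'; fun_prop

lemma hasDeriv_pev (q c n) (y : ℝ) : HasDerivAt (pev q c n) (pev' q c n y) y := by
  unfold pev pev'
  have := HasDerivAt.fun_sum (u := Finset.range (q + 1))
    (A := fun k y => c n k * y ^ k) (A' := fun k => c n k * ((k : ℝ) * y ^ (k - 1))) (x := y)
    (fun k _ => (hasDerivAt_pow k y).const_mul (c n k))
  refine this.congr_deriv (Finset.sum_congr rfl fun k _ => by ring)

lemma pev_sub (q) (c d : ℕ → ℕ → ℝ) (n y) :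
    pev q (fun n k => c n k - d n k) n y = pev q c n y - pev q d n y := by
  unfold pev; rw [← Finset.sum_sub_distrib]; exact Finset.sum_congr rfl fun k _ => by ring

lemma pev'_sub (q) (c d : ℕ → ℕ → ℝ) (n y) :
    pev' q (fun n k => c n k - d n k) n y = pev' q c n y - pev' q d n y := by
  unfold pev'; rw [← Finset.sum_sub_distrib]; exact Finset.sum_congr rfl fun k _ => by ring

lemma pev'_eq (q) (c : ℕ → ℕ → ℝ) (n y) :
    pev' q c n y = ∑ k ∈ Finset.range q, (((k : ℝ) + 1) * c n (k + 1)) * y ^ k := by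
  unfold pev'; rw [Finset.sum_range_succ']; simp

lemma Bm_sub (q N x) (u v Ψ : ℕ → ℕ → ℝ) :
    Bm q N x (fun n k => u n k - v n k) Ψ = Bm q N x u Ψ - Bm q N x v Ψ := by
  have h1 : ∀ n, (∫ y in (x n)..(x (n + 1)), pev' q (fun n k => u n k - v n k) n y * pev q Ψ n y)
      = (∫ y in (x n)..(x (n + 1)), pev' q u n y * pev q Ψ n y)
        - ∫ y in (x n)..(x (n + 1)), pev' q v n y * pev q Ψ n y := by
    intro n
    rw [← intervalIntegral.integral_sub]
    · simp only [pev'_sub, sub_mul]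
    · exact ((cont_pev' q u n).mul (cont_pev q Ψ n)).intervalIntegrable _ _
    · exact ((cont_pev' q v n).mul (cont_pev q Ψ n)).intervalIntegrable _ _
  have h2 : ∀ n, jmp q N x (fun n k => u n k - v n k) n = jmp q N x u n - jmp q N x v n := by
    intro n
    unfold jmp valL valR
    split_ifs <;> simp only [pev_sub] <;> ring
  unfold Bm
  simp only [h1, h2, sub_mul, Finset.sum_sub_distrib]
  ring

lemma shift_sum (N : ℕ) (hN : 2 ≤ N) (L a : ℕ → ℝ) (h0 : L 0 = a (N - 1))
    (hs : ∀ n, L (n + 1) = a n) :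
    ∑ n ∈ Finset.range N, L n = ∑ n ∈ Finset.range N, a n := by
  obtain ⟨M, rfl⟩ : ∃ M, N = M + 1 := ⟨N - 1, by omega⟩
  rw [Finset.sum_range_succ', Finset.sum_range_succ, h0]
  simp [hs]

lemma part_mono {N x} (hp : Partition N x) : ∀ m ≤ N, ∀ n ≤ m, x n ≤ x m := by
  intro m
  induction m with
  | zero => intro _ n hn; simp at hn; simp [hn]
  | succ m ih =>
    intro hm n hn
    rcases Nat.lt_or_ge n (m + 1) with h | h
    · exact (ih (by omega) n (by omega)).trans (hp.2.2.2 m (by omega)).le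
    · have : n = m + 1 := by omega
      rw [this]

lemma cell (q N : ℕ) (x : ℕ → ℝ) (hpart : Partition N x)
    (w : ℝ → ℝ) (hw : ContDiffOn ℝ 1 w (Set.Icc 0 1))
    (SP : ℕ → ℕ → ℝ) (hSP : IsSqPlus q N x w SP) (Ψ : ℕ → ℕ → ℝ) (n : ℕ) (hn : n < N) :
    IntervalIntegrable (fun y => derivWithin w (Set.Icc (0 : ℝ) 1) y * pev q Ψ n y) volume
      (x n) (x (n + 1)) ∧
    (∫ y in (x n)..(x (n + 1)), pev' q SP n y * pev q Ψ n y)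
      - (pev q SP n (x (n + 1)) - w (x (n + 1))) * pev q Ψ n (x (n + 1))
    = ∫ y in (x n)..(x (n + 1)), derivWithin w (Set.Icc (0 : ℝ) 1) y * pev q Ψ n y := by
  have hlt := hpart.2.2.2 n hn
  have ha : 0 ≤ x n := by rw [← hpart.2.1]; exact part_mono hpart n hn.le 0 (by omega)
  have hb : x (n + 1) ≤ 1 := by rw [← hpart.2.2.1]; exact part_mono hpart N le_rfl _ hn
  have hsub : Icc (x n) (x (n + 1)) ⊆ Icc (0 : ℝ) 1 := Icc_subset_Icc ha hb
  have hcd : ContinuousOn (derivWithin w (Set.Icc (0 : ℝ) 1)) (Icc (x n) (x (n + 1))) :=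
    (hw.continuousOn_derivWithin (uniqueDiffOn_Icc zero_lt_one) le_rfl).mono hsub
  have hcw : ContinuousOn w (Icc (x n) (x (n + 1))) := hw.continuousOn.mono hsub
  have cΨ := cont_pev q Ψ n
  have cS := cont_pev q SP n
  have cΨ' := cont_pev' q Ψ n
  have cS' := cont_pev' q SP n
  have i1 : IntervalIntegrable (fun y => derivWithin w (Set.Icc (0 : ℝ) 1) y * pev q Ψ n y) volume
      (x n) (x (n + 1)) :=
    (hcd.mul cΨ.continuousOn).intervalIntegrable_of_Icc hlt.le
  have i2 : IntervalIntegrable (fun y => pev' q SP n y * pev q Ψ n y) volume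
      (x n) (x (n + 1)) := (cS'.mul cΨ).intervalIntegrable _ _
  have i3 : IntervalIntegrable (fun y => (pev q SP n y - w y) * pev' q Ψ n y) volume
      (x n) (x (n + 1)) :=
    ((cS.continuousOn.sub hcw).mul cΨ'.continuousOn).intervalIntegrable_of_Icc hlt.le
  refine ⟨i1, ?_⟩
  have hz : ∫ y in (x n)..(x (n + 1)), (pev q SP n y - w y) * pev' q Ψ n y = 0 := by
    simp only [pev'_eq]
    exact (hSP n hn).2 (fun k => ((k : ℝ) + 1) * Ψ n (k + 1))
  have key := intervalIntegral.integral_eq_sub_of_hasDerivAt_of_le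
    (f := fun y => (pev q SP n y - w y) * pev q Ψ n y)
    (f' := fun y => (pev' q SP n y * pev q Ψ n y
      - derivWithin w (Set.Icc (0 : ℝ) 1) y * pev q Ψ n y)
      + (pev q SP n y - w y) * pev' q Ψ n y) hlt.le
    ((cS.continuousOn.sub hcw).mul cΨ.continuousOn) (by
      intro y hy
      have hy' : Icc (0 : ℝ) 1 ∈ nhds y :=
        Icc_mem_nhds (lt_of_le_of_lt ha hy.1) (lt_of_lt_of_le hy.2 hb)
      have hd : HasDerivAt w (derivWithin w (Set.Icc (0 : ℝ) 1) y) y :=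
        ((hw.differentiableOn one_ne_zero) y (mem_of_mem_nhds hy')).hasDerivWithinAt.hasDerivAt hy'
      exact (((hasDeriv_pev q SP n y).sub hd).mul (hasDeriv_pev q Ψ n y)).congr_deriv (by
        simp only [Pi.sub_apply]; ring))
    ((i2.sub i1).add i3)
  rw [intervalIntegral.integral_add (i2.sub i1) i3, intervalIntegral.integral_sub i2 i1, hz,
    (hSP n hn).1] at key
  linarith

lemma Bm_SP (q N : ℕ) (x : ℕ → ℝ) (hpart : Partition N x)
    (w : ℝ → ℝ) (hw : ContDiffOn ℝ 1 w (Set.Icc 0 1)) (hper : w 0 = w 1)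
    (SP : ℕ → ℕ → ℝ) (hSP : IsSqPlus q N x w SP) (Ψ : ℕ → ℕ → ℝ) :
    Bm q N x SP Ψ = ∑ n ∈ Finset.range N,
      ∫ y in (x n)..(x (n + 1)), derivWithin w (Set.Icc (0 : ℝ) 1) y * pev q Ψ n y := by
  have hN := hpart.1
  have e : ∑ n ∈ Finset.range N, jmp q N x SP n * valL q N x Ψ n
      = ∑ n ∈ Finset.range N, (pev q SP n (x (n + 1)) - w (x (n + 1))) * pev q Ψ n (x (n + 1)) := by
    rw [← shift_sum N hN (fun n => (valL q N x SP n - w (x n)) * valL q N x Ψ n)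
      (fun n => (pev q SP n (x (n + 1)) - w (x (n + 1))) * pev q Ψ n (x (n + 1)))]
    · refine Finset.sum_congr rfl fun n hn => ?_
      simp only [jmp, valR, (hSP n (Finset.mem_range.1 hn)).1]
    · have : N - 1 + 1 = N := by omega
      simp [valL, this, hpart.2.1, hpart.2.2.1, hper]
    · intro n; simp [valL]
  unfold Bm
  rw [e, ← Finset.sum_sub_distrib]
  exact Finset.sum_congr rfl fun n hn =>
    (cell q N x hpart w hw SP hSP Ψ n (Finset.mem_range.1 hn)).2

end DGaux

/-- Key estimate in the proof of Lemma "Properties of the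
projection operator Q", second assertion: let w ∈ C¹([0,1]) with w(0) = w(1),
let r ∈ V_q be mean-free and Q ∈ V_q with G⁻[Q] = r.  Then
‖G⁻[Q − S_q⁺[w]]‖_{L²(0,1)} ≤ ‖r − P_q[w′]‖_{L²(0,1)}, where P_q[w′] is the
L²-projection of the derivative w′ onto V_q.  Stated with squared norms;
elements of V_q are represented by cellwise polynomial coefficients. -/
theorem stmt_12 (q N : ℕ) (hq : 1 ≤ q) (x : ℕ → ℝ) (hpart : DG.Partition N x)
    (w : ℝ → ℝ) (hw : ContDiffOn ℝ 1 w (Set.Icc 0 1)) (hper : w 0 = w 1)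
    (r : ℕ → ℕ → ℝ) (hr : DG.intg q N x r = 0)
    (Q : ℕ → ℕ → ℝ) (hQ : DG.IsGminus q N x Q r)
    (SP : ℕ → ℕ → ℝ) (hSP : DG.IsSqPlus q N x w SP)
    (Pw : ℕ → ℕ → ℝ)
    (hPw : ∀ Ψ : ℕ → ℕ → ℝ,
      (∑ n ∈ Finset.range N,
        ∫ y in (x n)..(x (n + 1)),
          (DG.pev q Pw n y - derivWithin w (Set.Icc (0 : ℝ) 1) y) * DG.pev q Ψ n y) = 0)
    (A : ℕ → ℕ → ℝ)
    (hA : DG.IsGminus q N x (fun n k => Q n k - SP n k) A) :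
    DG.nsq q N x A ≤
      ∑ n ∈ Finset.range N,
        ∫ y in (x n)..(x (n + 1)), (DG.pev q r n y - DG.pev q Pw n y) ^ 2 := by
  have hproj : DG.inner2 q N x Pw A = ∑ n ∈ Finset.range N,
      ∫ y in (x n)..(x (n + 1)), derivWithin w (Set.Icc (0 : ℝ) 1) y * DG.pev q A n y := by
    have h := hPw A
    rw [← sub_eq_zero]
    refine Eq.trans ?_ h
    unfold DG.inner2
    rw [← Finset.sum_sub_distrib]
    refine Finset.sum_congr rfl fun n hn => ?_
    rw [← intervalIntegral.integral_sub]
    · simp only [sub_mul]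
    · exact ((DGaux.cont_pev q Pw n).mul (DGaux.cont_pev q A n)).intervalIntegrable _ _
    · exact (DGaux.cell q N x hpart w hw SP hSP A n (Finset.mem_range.1 hn)).1
  have h1 : DG.nsq q N x A = DG.inner2 q N x r A - DG.inner2 q N x Pw A := by
    have := hA A
    rw [DGaux.Bm_sub, ← hQ A, DGaux.Bm_SP q N x hpart w hw hper SP hSP, ← hproj] at this
    exact this
  have h2 : 0 ≤ ∑ n ∈ Finset.range N, ∫ y in (x n)..(x (n + 1)),
      (DG.pev q r n y - DG.pev q Pw n y - DG.pev q A n y) ^ 2 :=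
    Finset.sum_nonneg fun n hn => intervalIntegral.integral_nonneg
      (hpart.2.2.2 n (Finset.mem_range.1 hn)).le fun y _ => sq_nonneg _
  have h3 : ∑ n ∈ Finset.range N, ∫ y in (x n)..(x (n + 1)),
      (DG.pev q r n y - DG.pev q Pw n y - DG.pev q A n y) ^ 2
      = (∑ n ∈ Finset.range N,
        ∫ y in (x n)..(x (n + 1)), (DG.pev q r n y - DG.pev q Pw n y) ^ 2)
        - 2 * (DG.inner2 q N x r A - DG.inner2 q N x Pw A) + DG.nsq q N x A := by
    unfold DG.nsq DG.inner2
    rw [← Finset.sum_sub_distrib, Finset.mul_sum, ← Finset.sum_sub_distrib,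
      ← Finset.sum_add_distrib]
    refine Finset.sum_congr rfl fun n _ => ?_
    have cr := DGaux.cont_pev q r n
    have cP := DGaux.cont_pev q Pw n
    have cA := DGaux.cont_pev q A n
    rw [← intervalIntegral.integral_sub
        (Continuous.intervalIntegrable (by fun_prop) _ _)
        (Continuous.intervalIntegrable (by fun_prop) _ _),
      ← intervalIntegral.integral_const_mul,
      ← intervalIntegral.integral_sub (Continuous.intervalIntegrable (by fun_prop) _ _)
        (Continuous.intervalIntegrable (by fun_prop) _ _),
      ← intervalIntegral.integral_add (Continuous.intervalIntegrable (by fun_prop) _ _)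
        (Continuous.intervalIntegrable (by fun_prop) _ _)]
    congr 1
    funext y
    ring
  linarith
end
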